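/- arXiv:1712.06138 — 3 statements merged into one kernel-verified Lean document; each statement's English description precedes it below -/
import Mathlib

section
/- Uniqueness of nested layered representations (topological core of Theorem 2.1): Let n ≥ 1 and let Ω ⊂ ℝⁿ be a nonempty bounded open set. For i = 1, 2, let K_i ≥ 1 and let Ω^{(i)}_0 = Ω ⊃ Ω^{(i)}_1 ⊃ ... ⊃ Ω^{(i)}_{K_i} be nested nonempty open sets with closure(Ω^{(i)}_k) ⊂ Ω^{(i)}_{k-1} for k = 1, ..., K_i, each Ω^{(i)}_k regular open (equal to the interior of its closure), and with connected layers D^{(i)}_k = Ω^{(i)}_{k-1} \ closure(Ω^{(i)}_k) for k = 1, ..., K_i and D^{(i)}_{K_i+1} = Ω^{(i)}_{K_i}. Let σ^{(i)}_1, ..., σ^{(i)}_{K_i+1} be elements of a set S (e.g. real symmetric n×n matrices) satisfying the jump condition σ^{(i)}_k ≠ σ^{(i)}_{k+1} for k = 1, ..., K_i. If for every x ∈ Ω not lying on any of the boundaries ∂Ω^{(1)}_k, ∂Ω^{(2)}_k the layered piecewise constant functions agree, i.e. σ^{(1)}_k = σ^{(2)}_j whenever x ∈ D^{(1)}_k and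 x ∈ D^{(2)}_j, then K_1 = K_2 =: K, Ω^{(1)}_k = Ω^{(2)}_k for all k = 0, ..., K, and σ^{(1)}_{k+1} = σ^{(2)}_{k+1} for all k = 0, ..., K. -/
open Set

/-- A preconnected open set which meets the complement of `closure V`, but does not meet the
layer `V \ closure W` just inside `V`, lies outside `closure V`. -/
theorem IsPreconnected.subset_compl_closure_of_disjoint_layer {X : Type*} [TopologicalSpace X]
    {C V W : Set X} (hC : IsPreconnected C) (hCo : IsOpen C) (hV : IsOpen V)
    (hWV : closure W ⊆ V) (hmeet : (C ∩ (closure V)ᶜ).Nonempty)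
    (hdisj : Disjoint C (V \ closure W)) : C ⊆ (closure V)ᶜ := by
  refine hC.subset_left_of_subset_union isClosed_closure.isOpen_compl hV
    (disjoint_compl_left_iff_subset.2 subset_closure) (fun x hx => ?_) hmeet
  by_contra hxn
  simp only [mem_union, mem_compl_iff, not_or, not_not] at hxn
  obtain ⟨y, ⟨hyC, hyW⟩, hyV⟩ := mem_closure_iff.1 hxn.1 (C ∩ (closure W)ᶜ)
    (hCo.inter isClosed_closure.isOpen_compl) ⟨hx, fun h => hxn.2 (hWV h)⟩
  exact disjoint_left.1 hdisj hyC ⟨hyV, hyW⟩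

/-- A nonempty bounded open set in a nontrivial real normed space is not contained in a closed
subset of itself. -/
theorem Bornology.IsBounded.nonempty_diff_of_isClosed {E : Type*} [NormedAddCommGroup E]
    [NormedSpace ℝ E] [Nontrivial E] {U F : Set E} (hb : Bornology.IsBounded U) (hU : IsOpen U)
    (hne : U.Nonempty) (hF : IsClosed F) (hFU : F ⊆ U) : (U \ F).Nonempty := by
  rw [sdiff_nonempty]
  intro h
  obtain rfl : U = F := h.antisymm hFU
  have huniv : U = univ := IsClopen.eq_univ ⟨hF, hU⟩ hne
  exact NormedSpace.unbounded_univ ℝ E (huniv ▸ hb)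

/-- A nested family of regular open sets `O 0 ⊃ ⋯ ⊃ O K`, continued by `∅`, whose layers
`O k \ closure (O (k + 1))` are connected. -/
structure IsNestedFamily {X : Type*} [TopologicalSpace X] (K : ℕ) (O : ℕ → Set X) : Prop where
  isOpen : ∀ k, IsOpen (O k)
  nonempty_iff : ∀ k, (O k).Nonempty ↔ k ≤ K
  regular : ∀ k, O k = interior (closure (O k))
  closure_subset : ∀ k, closure (O (k + 1)) ⊆ O k
  isPreconnected_layer : ∀ k ≤ K, IsPreconnected (O k \ closure (O (k + 1)))

namespace IsNestedFamily

variable {X S : Type*} [TopologicalSpace X] {K L : ℕ} {O P : ℕ → Set X} {s t : ℕ → S}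

theorem antitone (h : IsNestedFamily K O) : Antitone O :=
  antitone_nat_of_succ_le fun k => subset_closure.trans (h.closure_subset k)

theorem isOpen_layer (h : IsNestedFamily K O) (k : ℕ) : IsOpen (O k \ closure (O (k + 1))) :=
  (h.isOpen k).sdiff isClosed_closure

theorem notMem_frontier (h : IsNestedFamily K O) {k : ℕ} {x : X}
    (hx : x ∈ O k \ closure (O (k + 1))) (j : ℕ) : x ∉ frontier (O j) := by
  intro hj
  rw [(h.isOpen j).frontier_eq] at hj
  rcases le_or_gt j k with hjk | hjk
  · exact hj.2 (h.antitone hjk hx.1)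
  · exact hx.2 (closure_mono (h.antitone hjk) hj.1)

theorem layer_subset_compl_closure (hO : IsNestedFamily K O) (hP : IsNestedFamily L P)
    (hjump : ∀ k < L, t k ≠ t (k + 1))
    (hagree : ∀ k ≤ K, ∀ j ≤ L, ∀ x ∈ O k \ closure (O (k + 1)),
      x ∈ P j \ closure (P (j + 1)) → s k = t j)
    {k : ℕ} (hk : k ≤ K)
    (hmeet : ((O k \ closure (O (k + 1))) ∩ (closure (P (k + 1)))ᶜ).Nonempty)
    (hst : s k = t k) : O k \ closure (O (k + 1)) ⊆ (closure (P (k + 1)))ᶜ := by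
  refine (hO.isPreconnected_layer k hk).subset_compl_closure_of_disjoint_layer
    (hO.isOpen_layer k) (hP.isOpen _) (hP.closure_subset (k + 1)) hmeet
    (disjoint_left.2 fun x hx hx' => ?_)
  have hL : k + 1 ≤ L := (hP.nonempty_iff _).1 ⟨x, hx'.1⟩
  exact hjump k hL (hst ▸ hagree k hk (k + 1) hL x hx hx')

theorem closure_subset_closure_of_layer_subset (hO : IsNestedFamily K O) {k : ℕ} {A : Set X}
    (h : A \ closure (P (k + 1)) ⊆ (closure (O (k + 1)))ᶜ) (hOA : O k = A) :
    closure (O (k + 1)) ⊆ closure (P (k + 1)) := by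
  intro x hx
  by_contra hxP
  exact h ⟨hOA ▸ hO.closure_subset k hx, hxP⟩ hx

end IsNestedFamily

section Uniqueness

variable {E S : Type*} [NormedAddCommGroup E] [NormedSpace ℝ E] [Nontrivial E] {K L : ℕ}
  {O P : ℕ → Set E} {s t : ℕ → S}

theorem IsNestedFamily.value_eq_of_eq (hO : IsNestedFamily K O) (hP : IsNestedFamily L P)
    (hb : Bornology.IsBounded (O 0))
    (hagree : ∀ k ≤ K, ∀ j ≤ L, ∀ x ∈ O k \ closure (O (k + 1)),
      x ∈ P j \ closure (P (j + 1)) → s k = t j)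
    {k : ℕ} (hk : k ≤ K) (heq : O k = P k) :
    s k = t k ∧
      ((O k \ closure (O (k + 1))) ∩ (P k \ closure (P (k + 1)))).Nonempty := by
  have hL : k ≤ L := (hP.nonempty_iff k).1 (heq ▸ (hO.nonempty_iff k).2 hk)
  obtain ⟨x, hxU, hx⟩ := (hb.subset (hO.antitone k.zero_le)).nonempty_diff_of_isClosed
    (hO.isOpen k) ((hO.nonempty_iff k).2 hk)
    ((isClosed_closure (s := O (k + 1))).union (isClosed_closure (s := P (k + 1))))
    (union_subset (hO.closure_subset k) (heq ▸ hP.closure_subset k))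
  rw [mem_union, not_or] at hx
  have hxO : x ∈ O k \ closure (O (k + 1)) := ⟨hxU, hx.1⟩
  have hxP : x ∈ P k \ closure (P (k + 1)) := ⟨heq ▸ hxU, hx.2⟩
  exact ⟨hagree k hk k hL x hxO hxP, x, hxO, hxP⟩

theorem IsNestedFamily.eq_succ_of_eq (hO : IsNestedFamily K O) (hP : IsNestedFamily L P)
    (hb : Bornology.IsBounded (O 0))
    (hjumpO : ∀ k < K, s k ≠ s (k + 1)) (hjumpP : ∀ k < L, t k ≠ t (k + 1))
    (hagree : ∀ k ≤ K, ∀ j ≤ L, ∀ x ∈ O k \ closure (O (k + 1)),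
      x ∈ P j \ closure (P (j + 1)) → s k = t j)
    {k : ℕ} (hk : k ≤ K) (heq : O k = P k) : O (k + 1) = P (k + 1) := by
  have hL : k ≤ L := (hP.nonempty_iff k).1 (heq ▸ (hO.nonempty_iff k).2 hk)
  obtain ⟨hst, x, hxO, hxP⟩ := hO.value_eq_of_eq hP hb hagree hk heq
  have h₁ := hO.layer_subset_compl_closure hP hjumpP hagree hk ⟨x, hxO, hxP.2⟩ hst
  have h₂ := hP.layer_subset_compl_closure hO hjumpO
    (fun i hi j hj y hy hy' => (hagree j hj i hi y hy' hy).symm) hL ⟨x, hxP, hxO.2⟩ hst.symm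
  rw [hO.regular (k + 1), hP.regular (k + 1),
    (hO.closure_subset_closure_of_layer_subset h₂ heq).antisymm
      (hP.closure_subset_closure_of_layer_subset h₁ heq.symm)]

theorem IsNestedFamily.unique (hO : IsNestedFamily K O) (hP : IsNestedFamily L P)
    (hb : Bornology.IsBounded (O 0)) (h0 : O 0 = P 0)
    (hjumpO : ∀ k < K, s k ≠ s (k + 1)) (hjumpP : ∀ k < L, t k ≠ t (k + 1))
    (hagree : ∀ k ≤ K, ∀ j ≤ L, ∀ x ∈ O k \ closure (O (k + 1)),
      x ∈ P j \ closure (P (j + 1)) → s k = t j) :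
    K = L ∧ (∀ k ≤ K, O k = P k) ∧ ∀ k ≤ K, s k = t k := by
  have heq : ∀ k ≤ K + 1, O k = P k := by
    intro k
    induction k with
    | zero => exact fun _ => h0
    | succ k ih =>
      exact fun hk => hO.eq_succ_of_eq hP hb hjumpO hjumpP hagree (by omega) (ih (by omega))
  have hKL : K ≤ L := (hP.nonempty_iff K).1 (heq K (by omega) ▸ (hO.nonempty_iff K).2 le_rfl)
  have hLK : ¬ K + 1 ≤ L := fun h => by
    have := (hO.nonempty_iff (K + 1)).1 ((heq (K + 1) le_rfl).symm ▸ (hP.nonempty_iff _).2 h)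
    omega
  exact ⟨by omega, fun k hk => heq k (by omega),
    fun k hk => (hO.value_eq_of_eq hP hb hagree hk (heq k (by omega))).1⟩

end Uniqueness

/-- The family `Om 0, …, Om K`, continued by the empty set. -/
def extendByEmpty {X : Type*} (K : ℕ) (Om : ℕ → Set X) (k : ℕ) : Set X :=
  if k ≤ K then Om k else ∅

section ExtendByEmpty

variable {X : Type*} {K : ℕ} {Om : ℕ → Set X}

theorem extendByEmpty_of_le {k : ℕ} (hk : k ≤ K) : extendByEmpty K Om k = Om k := if_pos hk

theorem extendByEmpty_of_lt {k : ℕ} (hk : K < k) : extendByEmpty K Om k = ∅ :=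
  if_neg (not_le.2 hk)

variable [TopologicalSpace X] {D : ℕ → Set X}

theorem extendByEmpty_layer (hD : ∀ k, 1 ≤ k → k ≤ K → D k = Om (k - 1) \ closure (Om k))
    (hDtop : D (K + 1) = Om K) {k : ℕ} (hk : k ≤ K) :
    extendByEmpty K Om k \ closure (extendByEmpty K Om (k + 1)) = D (k + 1) := by
  rw [extendByEmpty_of_le hk]
  rcases hk.lt_or_eq with h | rfl
  · rw [extendByEmpty_of_le (Nat.succ_le_of_lt h), hD (k + 1) (by omega) h, Nat.add_sub_cancel]
  · rw [extendByEmpty_of_lt k.lt_succ_self, closure_empty, sdiff_empty, hDtop]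

theorem isNestedFamily_extendByEmpty (hopen : ∀ k ≤ K, IsOpen (Om k))
    (hne : ∀ k ≤ K, (Om k).Nonempty) (hreg : ∀ k ≤ K, Om k = interior (closure (Om k)))
    (hnest : ∀ k, 1 ≤ k → k ≤ K → closure (Om k) ⊆ Om (k - 1))
    (hD : ∀ k, 1 ≤ k → k ≤ K → D k = Om (k - 1) \ closure (Om k))
    (hDtop : D (K + 1) = Om K) (hconn : ∀ k, 1 ≤ k → k ≤ K + 1 → IsConnected (D k)) :
    IsNestedFamily K (extendByEmpty K Om) where
  isOpen k := by
    unfold extendByEmpty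
    split_ifs with h
    exacts [hopen k h, isOpen_empty]
  nonempty_iff k := by
    unfold extendByEmpty
    split_ifs with h
    · exact iff_of_true (hne k h) h
    · exact iff_of_false not_nonempty_empty h
  regular k := by
    unfold extendByEmpty
    split_ifs with h
    · exact hreg k h
    · simp
  closure_subset k := by
    rcases le_or_gt (k + 1) K with h | h
    · rw [extendByEmpty_of_le h, extendByEmpty_of_le (by omega)]
      exact hnest (k + 1) (by omega) h
    · simp [extendByEmpty_of_lt h]
  isPreconnected_layer k hk := by
    rw [extendByEmpty_layer hD hDtop hk]
    exact (hconn (k + 1) (by omega) (by omega)).isPreconnected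

end ExtendByEmpty


/-- Uniqueness of nested layered representations (topological core of Theorem 2.1). -/
theorem uniqueness_nested_layered_representations
    {n : ℕ} (hn : 1 ≤ n) (S : Type*)
    (Ω : Set (EuclideanSpace ℝ (Fin n)))
    (hΩne : Ω.Nonempty) (hΩopen : IsOpen Ω) (hΩbdd : Bornology.IsBounded Ω)
    (K₁ K₂ : ℕ) (hK₁ : 1 ≤ K₁) (hK₂ : 1 ≤ K₂)
    (Om₁ Om₂ : ℕ → Set (EuclideanSpace ℝ (Fin n)))
    (σ₁ σ₂ : ℕ → S)
    (h0₁ : Om₁ 0 = Ω) (h0₂ : Om₂ 0 = Ω)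
    (hopen₁ : ∀ k ≤ K₁, IsOpen (Om₁ k)) (hopen₂ : ∀ k ≤ K₂, IsOpen (Om₂ k))
    (hne₁ : ∀ k ≤ K₁, (Om₁ k).Nonempty) (hne₂ : ∀ k ≤ K₂, (Om₂ k).Nonempty)
    (hreg₁ : ∀ k ≤ K₁, Om₁ k = interior (closure (Om₁ k)))
    (hreg₂ : ∀ k ≤ K₂, Om₂ k = interior (closure (Om₂ k)))
    (hnest₁ : ∀ k, 1 ≤ k → k ≤ K₁ → closure (Om₁ k) ⊆ Om₁ (k - 1))
    (hnest₂ : ∀ k, 1 ≤ k → k ≤ K₂ → closure (Om₂ k) ⊆ Om₂ (k - 1))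
    (D₁ D₂ : ℕ → Set (EuclideanSpace ℝ (Fin n)))
    (hD₁ : ∀ k, 1 ≤ k → k ≤ K₁ → D₁ k = Om₁ (k - 1) \ closure (Om₁ k))
    (hD₁top : D₁ (K₁ + 1) = Om₁ K₁)
    (hD₂ : ∀ k, 1 ≤ k → k ≤ K₂ → D₂ k = Om₂ (k - 1) \ closure (Om₂ k))
    (hD₂top : D₂ (K₂ + 1) = Om₂ K₂)
    (hconn₁ : ∀ k, 1 ≤ k → k ≤ K₁ + 1 → IsConnected (D₁ k))
    (hconn₂ : ∀ k, 1 ≤ k → k ≤ K₂ + 1 → IsConnected (D₂ k))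
    (hjump₁ : ∀ k, 1 ≤ k → k ≤ K₁ → σ₁ k ≠ σ₁ (k + 1))
    (hjump₂ : ∀ k, 1 ≤ k → k ≤ K₂ → σ₂ k ≠ σ₂ (k + 1))
    (hagree : ∀ x ∈ Ω,
      (∀ k ≤ K₁, x ∉ frontier (Om₁ k)) →
      (∀ k ≤ K₂, x ∉ frontier (Om₂ k)) →
      ∀ k j, 1 ≤ k → k ≤ K₁ + 1 → 1 ≤ j → j ≤ K₂ + 1 →
        x ∈ D₁ k → x ∈ D₂ j → σ₁ k = σ₂ j) :
    K₁ = K₂ ∧ (∀ k ≤ K₁, Om₁ k = Om₂ k) ∧ (∀ k ≤ K₁, σ₁ (k + 1) = σ₂ (k + 1)) := by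
  have : Nonempty (Fin n) := ⟨⟨0, hn⟩⟩
  have hO := isNestedFamily_extendByEmpty hopen₁ hne₁ hreg₁ hnest₁ hD₁ hD₁top hconn₁
  have hP := isNestedFamily_extendByEmpty hopen₂ hne₂ hreg₂ hnest₂ hD₂ hD₂top hconn₂
  have hO0 : extendByEmpty K₁ Om₁ 0 = Ω := (extendByEmpty_of_le K₁.zero_le).trans h0₁
  have hP0 : extendByEmpty K₂ Om₂ 0 = Ω := (extendByEmpty_of_le K₂.zero_le).trans h0₂
  obtain ⟨hK, heq, hσ⟩ := hO.unique (s := fun k => σ₁ (k + 1)) (t := fun k => σ₂ (k + 1)) hP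
    (hO0 ▸ hΩbdd) (hO0.trans hP0.symm) (fun k hk => hjump₁ (k + 1) (by omega) hk)
    (fun k hk => hjump₂ (k + 1) (by omega) hk) (fun k hk j hj x hx hx' =>
      hagree x (hO0 ▸ hO.antitone k.zero_le hx.1)
        (fun i hi => extendByEmpty_of_le (Om := Om₁) hi ▸ hO.notMem_frontier hx i)
        (fun i hi => extendByEmpty_of_le (Om := Om₂) hi ▸ hP.notMem_frontier hx' i)
        (k + 1) (j + 1) (by omega) (by omega) (by omega) (by omega)
        (extendByEmpty_layer hD₁ hD₁top hk ▸ hx) (extendByEmpty_layer hD₂ hD₂top hj ▸ hx'))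
  refine ⟨hK, fun k hk => ?_, hσ⟩
  rw [← extendByEmpty_of_le (Om := Om₁) hk, heq k hk, extendByEmpty_of_le (hK ▸ hk)]
end

section
/- Uniqueness of layered representations by graphs in a cylinder (core of the localized uniqueness theorem): Let n ≥ 2, R > 0, M ∈ ℝ, and let B'_R ⊂ ℝ^{n-1} be the open ball of radius R centered at 0. Let φ : B'_R → ℝ be continuous with φ(x') < M for all x'. For i = 1, 2, let K_i ≥ 1 and let φ^{(i)}_1, ..., φ^{(i)}_{K_i - 1} : B'_R → ℝ be continuous functions with φ(x') < φ^{(i)}_1(x') < ... < φ^{(i)}_{K_i-1}(x') < M for all x' ∈ B'_R; set φ^{(i)}_0 = φ and φ^{(i)}_{K_i} ≡ M, and define the layers D^{(i)}_k = { (x', x_n) : x' ∈ B'_R, φ^{(i)}_{k-1}(x') < x_n < φ^{(i)}_k(x') } for k = 1, ..., K_i. Let σ^{(i)}_1, ..., σ^{(i)}_{K_i} be elements of a set S with σ^{(i)}_k ≠ σ^{(i)}_{k+1} for k = 1, ..., K_i − 1. If for every point x of the open cylinder C° = { (x', x_n) : x' ∈ B'_R, φ(x') < x_n < M } lying on no graph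 of any φ^{(i)}_k one has σ^{(1)}_k = σ^{(2)}_j whenever x ∈ D^{(1)}_k and x ∈ D^{(2)}_j, then K_1 = K_2 =: K, φ^{(1)}_k = φ^{(2)}_k on B'_R for all k = 1, ..., K − 1, and σ^{(1)}_k = σ^{(2)}_k for all k = 1, ..., K. -/
/-- A finite sequence which increases at each step up to index `K` is strictly increasing there. -/
theorem lt_of_step_lt {K : ℕ} {a : ℕ → ℝ} (ha : ∀ k, k < K → a k < a (k + 1)) {i j : ℕ}
    (hij : i < j) (hj : j ≤ K) : a i < a j := by
  induction j, hij using Nat.le_induction with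
  | base => exact ha i hj
  | succ m _ ih => exact (ih (by omega)).trans (ha m hj)

/-- A point strictly between two consecutive nodes is different from every node. -/
theorem ne_node_of_mem_layer {K : ℕ} {a : ℕ → ℝ} (ha : ∀ k, k < K → a k < a (k + 1)) {k i : ℕ}
    {t : ℝ} (hk : k < K) (hl : a k < t) (hu : t < a (k + 1)) (hi : i ≤ K) : t ≠ a i := by
  rintro rfl
  rcases lt_trichotomy i k with h | rfl | h
  · exact lt_asymm hl (lt_of_step_lt ha h hk.le)
  · exact lt_irrefl _ hl
  · rcases (Nat.succ_le_of_lt h).eq_or_lt with h | h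
    · subst h
      exact lt_irrefl _ hu
    · exact lt_asymm hu (lt_of_step_lt ha h hi)

/-- If two step functions agree on overlapping layers and share the `k`-th node, the next node of
the first one does not precede the next node of the second one. -/
theorem next_node_le {S : Type*} {K L : ℕ} {a b : ℕ → ℝ} {σ τ : ℕ → S}
    (ha : ∀ k, k < K → a k < a (k + 1)) (hb : ∀ k, k < L → b k < b (k + 1))
    (hend : a K = b L) (hjump : ∀ k, k + 1 < K → σ (k + 1) ≠ σ (k + 2))
    (hagree : ∀ k j t, k < K → j < L → a k < t → t < a (k + 1) → b j < t → t < b (j + 1) →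
      σ (k + 1) = τ (j + 1))
    {k : ℕ} (hk : k < K) (hl : k < L) (hab : a k = b k) : b (k + 1) ≤ a (k + 1) := by
  by_contra! h
  have hbM : b (k + 1) ≤ b L := by
    rcases (Nat.succ_le_of_lt hl).eq_or_lt with e | e
    · exact le_of_eq (congrArg b e)
    · exact (lt_of_step_lt hb e le_rfl).le
  have hk1 : k + 1 < K := by
    refine lt_of_le_of_ne hk fun e => ?_
    rw [e] at h hbM
    linarith
  have h1 := ha k hk
  obtain ⟨s, hs, hs'⟩ := exists_between h1
  obtain ⟨t, ht, ht'⟩ := exists_between (lt_min (ha (k + 1) hk1) h)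
  have e1 := hagree k k s hk hl hs hs' (hab ▸ hs) (hs'.trans h)
  have e2 := hagree (k + 1) k t hk1 hl ht (ht'.trans_le (min_le_left _ _)) (by linarith)
    (ht'.trans_le (min_le_right _ _))
  exact hjump k hk1 (e1.trans e2.symm)

/-- Two step functions without removable jumps on a common interval that agree on overlapping
layers have the same number of steps, the same nodes and the same values. -/
theorem step_representation_unique {S : Type*} {K L : ℕ} {a b : ℕ → ℝ} {σ τ : ℕ → S}
    (ha : ∀ k, k < K → a k < a (k + 1)) (hb : ∀ k, k < L → b k < b (k + 1))
    (hstart : a 0 = b 0) (hend : a K = b L)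
    (hjσ : ∀ k, k + 1 < K → σ (k + 1) ≠ σ (k + 2))
    (hjτ : ∀ k, k + 1 < L → τ (k + 1) ≠ τ (k + 2))
    (hagree : ∀ k j t, k < K → j < L → a k < t → t < a (k + 1) → b j < t → t < b (j + 1) →
      σ (k + 1) = τ (j + 1)) :
    K = L ∧ (∀ k, k ≤ K → a k = b k) ∧ (∀ k, k < K → σ (k + 1) = τ (k + 1)) := by
  have nodes : ∀ k, k ≤ K → k ≤ L → a k = b k := by
    intro k
    induction k with
    | zero => exact fun _ _ => hstart
    | succ k ih =>
      intro hk hl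
      have hab := ih (by omega) (by omega)
      exact le_antisymm
        (next_node_le hb ha hend.symm hjτ
          (fun i j t hi hj h1 h2 h3 h4 => (hagree j i t hj hi h3 h4 h1 h2).symm) hl hk hab.symm)
        (next_node_le ha hb hend hjσ hagree hk hl hab)
  have hKL : K = L := by
    rcases lt_trichotomy K L with h | h | h
    · have h1 := lt_of_step_lt hb h le_rfl
      have h2 := nodes K le_rfl h.le
      linarith
    · exact h
    · have h1 := lt_of_step_lt ha h le_rfl
      have h2 := nodes L h.le le_rfl
      linarith
  subst hKL
  refine ⟨rfl, fun k hk => nodes k hk hk, fun k hk => ?_⟩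
  obtain ⟨t, ht, ht'⟩ := exists_between (ha k hk)
  exact hagree k k t hk hk ht ht' (nodes k hk.le hk.le ▸ ht) (nodes (k + 1) hk hk ▸ ht')

/-- Uniqueness of layered representations by graphs in a cylinder
(core of the localized uniqueness theorem). -/
theorem uniqueness_layered_representations_in_cylinder
    {n : ℕ} (hn : 2 ≤ n) (S : Type*) (R M : ℝ) (hR : 0 < R)
    (φ : EuclideanSpace ℝ (Fin (n - 1)) → ℝ)
    (hφcont : ContinuousOn φ (Metric.ball 0 R))
    (hφM : ∀ x' ∈ Metric.ball (0 : EuclideanSpace ℝ (Fin (n - 1))) R, φ x' < M)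
    (K₁ K₂ : ℕ) (hK₁ : 1 ≤ K₁) (hK₂ : 1 ≤ K₂)
    (φ₁ φ₂ : ℕ → EuclideanSpace ℝ (Fin (n - 1)) → ℝ)
    (σ₁ σ₂ : ℕ → S)
    (hφ₁0 : φ₁ 0 = φ) (hφ₂0 : φ₂ 0 = φ)
    (hφ₁K : ∀ x', φ₁ K₁ x' = M) (hφ₂K : ∀ x', φ₂ K₂ x' = M)
    (hcont₁ : ∀ k, 1 ≤ k → k ≤ K₁ - 1 → ContinuousOn (φ₁ k) (Metric.ball 0 R))
    (hcont₂ : ∀ k, 1 ≤ k → k ≤ K₂ - 1 → ContinuousOn (φ₂ k) (Metric.ball 0 R))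
    (horder₁ : ∀ k, k < K₁ →
      ∀ x' ∈ Metric.ball (0 : EuclideanSpace ℝ (Fin (n - 1))) R,
        φ₁ k x' < φ₁ (k + 1) x')
    (horder₂ : ∀ k, k < K₂ →
      ∀ x' ∈ Metric.ball (0 : EuclideanSpace ℝ (Fin (n - 1))) R,
        φ₂ k x' < φ₂ (k + 1) x')
    (hjump₁ : ∀ k, 1 ≤ k → k ≤ K₁ - 1 → σ₁ k ≠ σ₁ (k + 1))
    (hjump₂ : ∀ k, 1 ≤ k → k ≤ K₂ - 1 → σ₂ k ≠ σ₂ (k + 1))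
    (hagree : ∀ x' ∈ Metric.ball (0 : EuclideanSpace ℝ (Fin (n - 1))) R,
      ∀ t : ℝ, φ x' < t → t < M →
      (∀ k, 1 ≤ k → k ≤ K₁ - 1 → t ≠ φ₁ k x') →
      (∀ k, 1 ≤ k → k ≤ K₂ - 1 → t ≠ φ₂ k x') →
      ∀ k j, 1 ≤ k → k ≤ K₁ → 1 ≤ j → j ≤ K₂ →
        φ₁ (k - 1) x' < t → t < φ₁ k x' →
        φ₂ (j - 1) x' < t → t < φ₂ j x' →
        σ₁ k = σ₂ j) :
    K₁ = K₂ ∧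
      (∀ k, 1 ≤ k → k ≤ K₁ - 1 →
        ∀ x' ∈ Metric.ball (0 : EuclideanSpace ℝ (Fin (n - 1))) R,
          φ₁ k x' = φ₂ k x') ∧
      (∀ k, 1 ≤ k → k ≤ K₁ → σ₁ k = σ₂ k) := by
  have pointwise : ∀ x' ∈ Metric.ball (0 : EuclideanSpace ℝ (Fin (n - 1))) R,
      K₁ = K₂ ∧ (∀ k, k ≤ K₁ → φ₁ k x' = φ₂ k x') ∧
        (∀ k, k < K₁ → σ₁ (k + 1) = σ₂ (k + 1)) := by
    intro x' hx
    have ha : ∀ k, k < K₁ → φ₁ k x' < φ₁ (k + 1) x' := fun k hk => horder₁ k hk x' hx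
    have hb : ∀ k, k < K₂ → φ₂ k x' < φ₂ (k + 1) x' := fun k hk => horder₂ k hk x' hx
    refine step_representation_unique (a := fun k => φ₁ k x') (b := fun k => φ₂ k x') ha hb
      (by simp only [hφ₁0, hφ₂0]) (by simp only [hφ₁K, hφ₂K])
      (fun k hk => hjump₁ (k + 1) (by omega) (by omega))
      (fun k hk => hjump₂ (k + 1) (by omega) (by omega)) ?_
    intro k j t hk hj h1 h2 h3 h4
    have hlow : φ x' < t := by
      rcases Nat.eq_zero_or_pos k with rfl | h
      · exact hφ₁0 ▸ h1
      · have := lt_of_step_lt (a := fun k => φ₁ k x') ha h hk.le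
        simp only [hφ₁0] at this
        exact this.trans h1
    have hup : t < M := by
      rcases (Nat.succ_le_of_lt hk).eq_or_lt with h | h
      · exact hφ₁K x' ▸ h ▸ h2
      · have := lt_of_step_lt (a := fun k => φ₁ k x') ha h le_rfl
        simp only [hφ₁K] at this
        exact h2.trans this
    exact hagree x' hx t hlow hup
      (fun i _ hi => ne_node_of_mem_layer (a := fun k => φ₁ k x') ha hk h1 h2 (by omega))
      (fun i _ hi => ne_node_of_mem_layer (a := fun k => φ₂ k x') hb hj h3 h4 (by omega))
      (k + 1) (j + 1) (by omega) hk (by omega) hj h1 h2 h3 h4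
  obtain ⟨hK, -, hσ⟩ := pointwise 0 (Metric.mem_ball_self hR)
  refine ⟨hK, fun k _ hk x' hx => (pointwise x' hx).2.1 k (by omega), fun k hk hk' => ?_⟩
  obtain ⟨m, rfl⟩ := Nat.exists_eq_add_of_le' hk
  exact hσ m hk'
end

section
/- A symmetric matrix vanishing on tangent hyperplanes over an open set of normals is zero (linear-algebraic core of the determination of the metric from tangential data): Let n ≥ 3 be an integer, let T be a real symmetric n×n matrix, and let U be a nonempty open subset of the unit sphere S^{n-1} ⊂ ℝⁿ. Suppose that for every ν ∈ U and for all vectors ξ, η ∈ ℝⁿ with ξ·ν = 0 and η·ν = 0 one has ξᵀ T η = 0. Then T = 0. -/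
open Filter Topology in
/-- In a real inner product space of dimension at least three, a bilinear form whose quadratic form
vanishes on `ν^⊥` for all unit vectors `ν` in an open set meeting the sphere has zero quadratic
form. -/
theorem bilin_self_eq_zero_of_vanishing_on_tangent_hyperplanes
    {E : Type*} [NormedAddCommGroup E] [InnerProductSpace ℝ E] [FiniteDimensional ℝ E]
    (hE : 3 ≤ Module.finrank ℝ E) (B : E →ₗ[ℝ] E →ₗ[ℝ] ℝ) {V : Set E} (hV : IsOpen V)
    {ν₀ : E} (hν₀ : ν₀ ∈ V) (hnorm : ‖ν₀‖ = 1)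
    (hB : ∀ ν ∈ V, ‖ν‖ = 1 → ∀ ξ, inner ℝ ν ξ = 0 → B ξ ξ = 0) (x : E) : B x x = 0 := by
  obtain ⟨y, hy, hy0⟩ : ∃ y ∈ (Submodule.span ℝ {ν₀, x})ᗮ, y ≠ 0 := by
    refine Submodule.exists_mem_ne_zero_of_ne_bot fun h ↦ ?_
    have hsum := (Submodule.span ℝ {ν₀, x}).finrank_add_finrank_orthogonal
    have hle : Module.finrank ℝ (Submodule.span ℝ {ν₀, x}) ≤ 2 := by
      classical
      have := finrank_span_finset_le_card (R := ℝ) ({ν₀, x} : Finset E)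
      rw [Finset.coe_insert, Finset.coe_singleton] at this
      exact this.trans Finset.card_le_two
    rw [h, finrank_bot] at hsum
    omega
  rw [Submodule.mem_orthogonal] at hy
  have hνy : inner ℝ ν₀ y = 0 := hy _ (Submodule.subset_span (by simp))
  have hyx : inner ℝ y x = 0 := by
    rw [real_inner_comm]
    exact hy _ (Submodule.subset_span (by simp))
  have hyy : inner ℝ y y ≠ 0 := inner_self_ne_zero.mpr hy0
  set w : ℝ → E := fun t ↦ ν₀ - (t * (inner ℝ ν₀ x / inner ℝ y y)) • y with hw
  have hwc : Continuous w := by fun_prop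
  have hw0 : w 0 = ν₀ := by simp [hw]
  have hwne : ‖w 0‖ ≠ 0 := by simp [hw0, hnorm]
  have hmem : ∀ᶠ t in 𝓝 (0 : ℝ), ‖w t‖⁻¹ • w t ∈ V := by
    refine ((hwc.norm.continuousAt.inv₀ hwne).smul hwc.continuousAt).eventually_mem
      (hV.mem_nhds ?_)
    simpa [hw0, hnorm] using hν₀
  have hvan : ∀ᶠ t in 𝓝 (0 : ℝ), B (y + t • x) (y + t • x) = 0 := by
    filter_upwards [hmem, hwc.norm.continuousAt.eventually_ne hwne] with t ht htne
    refine hB _ ht (by simp [norm_smul, htne]) _ ?_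
    have horth : inner ℝ (w t) (y + t • x) = 0 := by
      simp only [hw, real_inner_smul_left, inner_sub_left, inner_add_right, real_inner_smul_right,
        hνy, hyx]
      field_simp
      ring
    rw [real_inner_smul_left, horth, mul_zero]
  have hneg : ∀ᶠ t in 𝓝 (0 : ℝ), B (y + (-t) • x) (y + (-t) • x) = 0 := by
    have : Tendsto (fun t : ℝ ↦ -t) (𝓝 0) (𝓝 0) := by simpa using (continuous_neg.tendsto (0 : ℝ))
    exact this.eventually hvan
  have hy_self : B y y = 0 := by simpa using hvan.self_of_nhds
  obtain ⟨t, ⟨h₁, h₂⟩, ht⟩ :=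
    (((hvan.and hneg).filter_mono nhdsWithin_le_nhds).and
      (self_mem_nhdsWithin (a := (0 : ℝ)) (s := {0}ᶜ))).exists
  have ht : t ≠ 0 := ht
  simp only [map_add, map_smul, LinearMap.add_apply, LinearMap.smul_apply, smul_eq_mul, hy_self]
    at h₁ h₂
  have : t ^ 2 * B x x = 0 := by linear_combination (h₁ + h₂) / 2
  simpa [ht] using this

/-- A symmetric matrix vanishing on tangent hyperplanes over an open set of
normals is zero. -/
theorem symm_matrix_vanishing_on_tangent_hyperplanes_eq_zero
    {n : ℕ} (hn : 3 ≤ n) (T : Matrix (Fin n) (Fin n) ℝ) (hT : T.IsSymm)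
    (U : Set (EuclideanSpace ℝ (Fin n)))
    (hUsub : U ⊆ Metric.sphere 0 1) (hUne : U.Nonempty)
    (hUopen : ∃ V : Set (EuclideanSpace ℝ (Fin n)),
      IsOpen V ∧ U = V ∩ Metric.sphere 0 1)
    (hvanish : ∀ ν ∈ U, ∀ ξ η : EuclideanSpace ℝ (Fin n),
      (∑ i, ξ i * ν i) = 0 → (∑ i, η i * ν i) = 0 →
      (∑ i, ∑ j, ξ i * T i j * η j) = 0) :
    T = 0 := by
  obtain ⟨V, hV, rfl⟩ := hUopen
  obtain ⟨ν₀, hν₀, hnorm⟩ := hUne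
  let e := (WithLp.linearEquiv 2 ℝ (Fin n → ℝ)).toLinearMap
  have hself := bilin_self_eq_zero_of_vanishing_on_tangent_hyperplanes (by simpa using hn)
    ((Matrix.toBilin' T).compl₁₂ e e) hV hν₀ (by simpa using hnorm) fun ν hν hν1 ξ hξ ↦ by
      have hξ' : ∑ i, ξ i * ν i = 0 := by simpa [PiLp.inner_apply] using hξ
      simpa [e, Matrix.toBilin'_apply] using hvanish ν ⟨hν, by simpa using hν1⟩ ξ ξ hξ' hξ'
  have hquad (v : Fin n → ℝ) : Matrix.toBilin' T v v = 0 := hself (WithLp.toLp 2 v)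
  ext i j
  have hij := hquad (Pi.single i 1 + Pi.single j 1)
  have hi := hquad (Pi.single i 1)
  have hj := hquad (Pi.single j 1)
  simp only [map_add, LinearMap.add_apply, Matrix.toBilin'_single] at hij hi hj
  have hsymm := hT.apply i j
  simp only [Matrix.zero_apply]
  linarith
end
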